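/- Let σ : ℝ³ → ℝ be a bounded measurable function with compact support. Then the double integral ∫∫ σ(X) σ(Y) / (4π|X - Y|) dX dY is nonnegative. -/

import Mathlib

open MeasureTheory Real

lemma gauss_conv (a : ℝ) (x y z : EuclideanSpace ℝ (Fin 3)) :
    rexp (-a * ‖x - z‖ ^ 2) * rexp (-a * ‖y - z‖ ^ 2)
      = rexp (-(a / 2) * ‖x - y‖ ^ 2) * rexp (-(2 * a) * ‖z - (1 / 2 : ℝ) • (x + y)‖ ^ 2) := by
  rw [← Real.exp_add, ← Real.exp_add]
  congr 1
  have h := parallelogram_law_with_norm ℝ (x - z) (y - z)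
  have e1 : x - z + (y - z) = -(2 : ℝ) • (z - (1 / 2 : ℝ) • (x + y)) := by module
  have e2 : x - z - (y - z) = x - y := by abel
  rw [e1, e2, norm_smul] at h
  have e3 : ‖(-(2 : ℝ))‖ = 2 := by norm_num
  rw [e3] at h
  linear_combination (-a / 2) * (-h)

lemma gauss_integrable {a : ℝ} (ha : 0 < a) :
    Integrable (fun z : EuclideanSpace ℝ (Fin 3) => rexp (-a * ‖z‖ ^ 2)) := by
  have h := (GaussianFourier.integrable_cexp_neg_mul_sq_norm_add (V := EuclideanSpace ℝ (Fin 3)) (b := (a : ℂ))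
    (by simpa using ha) 0 0).norm
  refine h.congr (Filter.Eventually.of_forall fun z => ?_)
  simp [Complex.norm_exp, ← Complex.ofReal_pow, ← Complex.ofReal_mul]

lemma gauss_nonneg (σ : EuclideanSpace ℝ (Fin 3) → ℝ) (hσ : Measurable σ) (hi : Integrable σ) {a : ℝ} (ha : 0 < a) :
    0 ≤ ∫ p : EuclideanSpace ℝ (Fin 3) × EuclideanSpace ℝ (Fin 3), σ p.1 * σ p.2 * rexp (-(a / 2) * ‖p.1 - p.2‖ ^ 2) := by
  set C : ℝ := ∫ z : EuclideanSpace ℝ (Fin 3), rexp (-(2 * a) * ‖z‖ ^ 2) with hC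
  have hg := gauss_integrable (a := 2 * a) (by positivity)
  have hCpos : 0 < C := integral_exp_pos hg
  have hsl : ∀ x y : EuclideanSpace ℝ (Fin 3), ∫ z : EuclideanSpace ℝ (Fin 3), rexp (-a * ‖x - z‖ ^ 2) * rexp (-a * ‖y - z‖ ^ 2)
      = rexp (-(a / 2) * ‖x - y‖ ^ 2) * C := by
    intro x y
    simp_rw [gauss_conv a x y]
    rw [integral_const_mul, hC,
      integral_sub_right_eq_self (fun z : EuclideanSpace ℝ (Fin 3) => rexp (-(2 * a) * ‖z‖ ^ 2))]
  have hii : ∀ x y : EuclideanSpace ℝ (Fin 3), Integrable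
      (fun z : EuclideanSpace ℝ (Fin 3) => rexp (-a * ‖x - z‖ ^ 2) * rexp (-a * ‖y - z‖ ^ 2)) := by
    intro x y
    simp_rw [gauss_conv a x y]
    exact (hg.comp_sub_right _).const_mul _
  have hprod : Integrable (fun p : EuclideanSpace ℝ (Fin 3) × EuclideanSpace ℝ (Fin 3) => σ p.1 * σ p.2) := hi.mul_prod hi
  let F : EuclideanSpace ℝ (Fin 3) × EuclideanSpace ℝ (Fin 3) → EuclideanSpace ℝ (Fin 3) → ℝ := fun p z =>
    σ p.1 * σ p.2 * (rexp (-a * ‖p.1 - z‖ ^ 2) * rexp (-a * ‖p.2 - z‖ ^ 2))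
  have hF : Integrable (Function.uncurry F) (volume.prod volume) := by
    have hm : Measurable (Function.uncurry F) := by
      unfold F Function.uncurry
      fun_prop
    rw [integrable_prod_iff hm.aestronglyMeasurable]
    constructor
    · exact Filter.Eventually.of_forall fun p => (hii p.1 p.2).const_mul (σ p.1 * σ p.2)
    · have : (fun p : EuclideanSpace ℝ (Fin 3) × EuclideanSpace ℝ (Fin 3) => ∫ z, ‖Function.uncurry F (p, z)‖) = fun p : EuclideanSpace ℝ (Fin 3) × EuclideanSpace ℝ (Fin 3) =>
          (rexp (-(a / 2) * ‖p.1 - p.2‖ ^ 2) * C) * ‖σ p.1 * σ p.2‖ := by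
        funext p
        simp only [Function.uncurry, F, norm_mul, Real.norm_eq_abs, Real.abs_exp]
        rw [integral_const_mul, hsl, mul_comm]
      rw [this]
      refine hprod.norm.bdd_mul (c := C) ?_ ?_
      · exact Measurable.aestronglyMeasurable (by fun_prop)
      · refine Filter.Eventually.of_forall fun p => ?_
        rw [Real.norm_of_nonneg (by positivity)]
        have : rexp (-(a / 2) * ‖p.1 - p.2‖ ^ 2) ≤ 1 := by
          rw [Real.exp_le_one_iff]
          have : 0 ≤ (a / 2) * ‖p.1 - p.2‖ ^ 2 := by positivity
          linarith
        nlinarith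
  have hswap := integral_integral_swap hF
  have hL : ∫ p : EuclideanSpace ℝ (Fin 3) × EuclideanSpace ℝ (Fin 3), ∫ z, F p z
      = (∫ p : EuclideanSpace ℝ (Fin 3) × EuclideanSpace ℝ (Fin 3), σ p.1 * σ p.2 * rexp (-(a / 2) * ‖p.1 - p.2‖ ^ 2)) * C := by
    rw [← integral_mul_const]
    congr 1
    funext p
    simp only [F]
    rw [integral_const_mul, hsl]
    ring
  have hR : 0 ≤ ∫ z, ∫ p : EuclideanSpace ℝ (Fin 3) × EuclideanSpace ℝ (Fin 3), F p z := by
    refine integral_nonneg fun z => ?_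
    have : ∫ p : EuclideanSpace ℝ (Fin 3) × EuclideanSpace ℝ (Fin 3), F p z = (∫ x, σ x * rexp (-a * ‖x - z‖ ^ 2)) *
        (∫ x, σ x * rexp (-a * ‖x - z‖ ^ 2)) := by
      rw [← integral_prod_mul]
      congr 1
      funext p
      simp only [F]
      ring
    simp only [Pi.zero_apply, this]
    exact mul_self_nonneg _
  rw [← hswap, hL] at hR
  exact nonneg_of_mul_nonneg_left hR hCpos

/-- The Newtonian energy of a bounded measurable function with compact support
is nonnegative. -/
theorem newtonian_energy_nonneg
    (σ : EuclideanSpace ℝ (Fin 3) → ℝ) (hmeas : Measurable σ)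
    (hbd : ∃ M, ∀ x, |σ x| ≤ M) (hsupp : HasCompactSupport σ) :
    0 ≤ ∫ p : EuclideanSpace ℝ (Fin 3) × EuclideanSpace ℝ (Fin 3),
        σ p.1 * σ p.2 / (4 * π * ‖p.1 - p.2‖) := by
  by_cases hint : Integrable (fun p : EuclideanSpace ℝ (Fin 3) × EuclideanSpace ℝ (Fin 3) => σ p.1 * σ p.2 / (4 * π * ‖p.1 - p.2‖))
  swap
  · rw [integral_undef hint]
  have hi : Integrable σ := by
    obtain ⟨M, hM⟩ := hbd
    rw [← integrableOn_iff_integrable_of_support_subset (subset_tsupport σ)]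
    exact Measure.integrableOn_of_bounded (M := M) hsupp.isCompact.measure_lt_top.ne
      hmeas.aestronglyMeasurable (Filter.Eventually.of_forall hM)
  have hK : ∀ p : EuclideanSpace ℝ (Fin 3) × EuclideanSpace ℝ (Fin 3), ∫ s : ℝ, rexp (-(‖p.1 - p.2‖ ^ 2) * s ^ 2)
      = (4 * π * √π) * (1 / (4 * π * ‖p.1 - p.2‖)) := by
    intro p
    rw [integral_gaussian, Real.sqrt_div pi_pos.le, Real.sqrt_sq (norm_nonneg _)]
    by_cases h : ‖p.1 - p.2‖ = 0
    · simp [h]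
    · field_simp
  have hdiag : ∀ᵐ p : EuclideanSpace ℝ (Fin 3) × EuclideanSpace ℝ (Fin 3), p.1 ≠ p.2 := by
    have hms : MeasurableSet {p : EuclideanSpace ℝ (Fin 3) × EuclideanSpace ℝ (Fin 3) | p.1 = p.2} :=
      measurableSet_eq_fun measurable_fst measurable_snd
    have : (volume : Measure (EuclideanSpace ℝ (Fin 3) × EuclideanSpace ℝ (Fin 3))) {p : EuclideanSpace ℝ (Fin 3) × EuclideanSpace ℝ (Fin 3) | p.1 = p.2} = 0 := by
      rw [Measure.volume_eq_prod, Measure.measure_prod_null hms]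
      refine Filter.Eventually.of_forall fun x => ?_
      have : (Prod.mk x ⁻¹' {p : EuclideanSpace ℝ (Fin 3) × EuclideanSpace ℝ (Fin 3) | p.1 = p.2}) = {x} := by
        ext y; simp [eq_comm]
      simp [this]
    rw [ae_iff]
    simpa using this
  let F : EuclideanSpace ℝ (Fin 3) × EuclideanSpace ℝ (Fin 3) → ℝ → ℝ := fun p s => σ p.1 * σ p.2 * rexp (-(‖p.1 - p.2‖ ^ 2) * s ^ 2)
  have hF : Integrable (Function.uncurry F) (volume.prod volume) := by
    have hm : Measurable (Function.uncurry F) := by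
      unfold F Function.uncurry
      fun_prop
    rw [integrable_prod_iff hm.aestronglyMeasurable]
    constructor
    · filter_upwards [hdiag] with p hp
      have : 0 < ‖p.1 - p.2‖ := norm_pos_iff.2 (sub_ne_zero.2 hp)
      have h2 : 0 < ‖p.1 - p.2‖ ^ 2 := by positivity
      exact (integrable_exp_neg_mul_sq h2).const_mul (σ p.1 * σ p.2)
    · refine (hint.norm.const_mul (4 * π * √π)).congr (Filter.Eventually.of_forall fun p => ?_)
      simp only [Function.uncurry, F, norm_mul, Real.norm_eq_abs, Real.abs_exp]
      rw [integral_const_mul, hK, abs_div, abs_mul,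
        abs_of_nonneg (show 0 ≤ 4 * π * ‖p.1 - p.2‖ by positivity)]
      ring
  have hswap := integral_integral_swap hF
  have hL : ∫ p : EuclideanSpace ℝ (Fin 3) × EuclideanSpace ℝ (Fin 3), ∫ s, F p s
      = (∫ p : EuclideanSpace ℝ (Fin 3) × EuclideanSpace ℝ (Fin 3), σ p.1 * σ p.2 / (4 * π * ‖p.1 - p.2‖)) * (4 * π * √π) := by
    rw [← integral_mul_const]
    congr 1
    funext p
    simp only [F]
    rw [integral_const_mul, hK]
    ring
  have hR : 0 ≤ ∫ s, ∫ p : EuclideanSpace ℝ (Fin 3) × EuclideanSpace ℝ (Fin 3), F p s := by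
    refine integral_nonneg fun s => ?_
    by_cases hs : s = 0
    · have : ∫ p : EuclideanSpace ℝ (Fin 3) × EuclideanSpace ℝ (Fin 3), F p s = (∫ x, σ x) * (∫ x, σ x) := by
        rw [← integral_prod_mul]
        congr 1
        funext p
        simp [F, hs]
      simp only [Pi.zero_apply, this]
      exact mul_self_nonneg _
    · have := gauss_nonneg σ hmeas hi (a := 2 * s ^ 2) (by positivity)
      have e : ∫ p : EuclideanSpace ℝ (Fin 3) × EuclideanSpace ℝ (Fin 3), F p s
          = ∫ p : EuclideanSpace ℝ (Fin 3) × EuclideanSpace ℝ (Fin 3), σ p.1 * σ p.2 * rexp (-(2 * s ^ 2 / 2) * ‖p.1 - p.2‖ ^ 2) := by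
        congr 1
        funext p
        simp only [F]
        congr 2
        ring
      simp only [Pi.zero_apply, e]
      exact this
  rw [← hswap, hL] at hR
  exact nonneg_of_mul_nonneg_left hR (by positivity)
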